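/- There exists a sequence A of computable dimension 1 that is not Church random: take a computably random sequence R and set A(n) = R(n) for n not a power of 2 and A(n) = 0 for n a power of 2; then A is not Church random, while the singleton {A} has computable dimension 1. -/

import Mathlib

open Filter Topology

abbrev Cantor := ℕ → Bool

/-- The length-`n` prefix of an infinite binary sequence, as a list. -/
def pref (X : ℕ → Bool) (n : ℕ) : List Bool := (List.range n).map X

/-- An `s`-gale: a nonnegative function on strings satisfying the averaging
condition `2^s d(w) = d(w0) + d(w1)`. -/
def IsSGale (s : ℝ) (d : List Bool → ℝ) : Prop :=
  (∀ w, 0 ≤ d w) ∧ ∀ w, (2 : ℝ) ^ s * d w = d (w ++ [false]) + d (w ++ [true])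

/-- A real-valued function on strings is lower semicomputable (constructive):
it is the pointwise monotone limit of a computable rational approximation. -/
def LowerSemicomputable (d : List Bool → ℝ) : Prop :=
  ∃ g : List Bool → ℕ → ℚ, Computable₂ g ∧
    (∀ w, Monotone fun i => (g w i : ℝ)) ∧
    ∀ w, Filter.Tendsto (fun i => (g w i : ℝ)) Filter.atTop (nhds (d w))

/-- `d` succeeds on `X`: `limsup_n d(X↾n) = ∞`, i.e. `d` is unbounded on the
prefixes of `X`. -/
def SucceedsOn (d : List Bool → ℝ) (X : Cantor) : Prop :=
  ∀ C : ℝ, ∃ n, C < d (pref X n)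

/-- `d` strongly succeeds on `X`: `liminf_n d(X↾n) = ∞`. -/
def StronglySucceedsOn (d : List Bool → ℝ) (X : Cantor) : Prop :=
  ∀ C : ℝ, ∃ N, ∀ n ≥ N, C < d (pref X n)

/-- The constructive dimension of a class: the infimum of all `s ≥ 0` such that
some constructive (lower semicomputable) `s`-gale succeeds on every member. -/
noncomputable def cdim (A : Set Cantor) : ℝ :=
  sInf {s : ℝ | 0 ≤ s ∧ ∃ d : List Bool → ℝ,
    LowerSemicomputable d ∧ IsSGale s d ∧ ∀ X ∈ A, SucceedsOn d X}

/-- The constructive strong dimension of a class: the infimum of all `s ≥ 0`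
such that some constructive `s`-gale strongly succeeds on every member. -/
noncomputable def cDim (A : Set Cantor) : ℝ :=
  sInf {s : ℝ | 0 ≤ s ∧ ∃ d : List Bool → ℝ,
    LowerSemicomputable d ∧ IsSGale s d ∧ ∀ X ∈ A, StronglySucceedsOn d X}

/-- A martingale: nonnegative with `2d(w) = d(w0) + d(w1)`. -/
def IsMartingale (d : List Bool → ℝ) : Prop :=
  (∀ w, 0 ≤ d w) ∧ ∀ w, 2 * d w = d (w ++ [false]) + d (w ++ [true])

/-- A real-valued function on strings is computable: it has a computable
rational approximation to within `2⁻ⁿ`. -/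
def ComputableRealFun (d : List Bool → ℝ) : Prop :=
  ∃ g : List Bool → ℕ → ℚ, Computable₂ g ∧
    ∀ w n, |d w - (g w n : ℝ)| ≤ (2 : ℝ)⁻¹ ^ n

/-- A sequence is computably random if no computable martingale succeeds on it. -/
def ComputablyRandom (R : Cantor) : Prop :=
  ∀ d : List Bool → ℝ, ComputableRealFun d → IsMartingale d → ¬ SucceedsOn d R

/-- The computable dimension of a class: the infimum of all `s ≥ 0` such that
some computable `s`-gale succeeds on every member. -/
noncomputable def compdim (A : Set Cantor) : ℝ :=
  sInf {s : ℝ | 0 ≤ s ∧ ∃ d : List Bool → ℝ,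
    ComputableRealFun d ∧ IsSGale s d ∧ ∀ X ∈ A, SucceedsOn d X}

/-- The number of positions `i < n` selected from `A` by the selection rule `φ`
(which scans the prefix `A↾i` to decide whether to select position `i`). -/
def selCount (φ : List Bool → Bool) (A : Cantor) (n : ℕ) : ℕ :=
  ((List.range n).filter fun i => φ (pref A i)).length

/-- The number of positions `i < n` selected from `A` by `φ` where `A i = 1`. -/
def selOnes (φ : List Bool → Bool) (A : Cantor) (n : ℕ) : ℕ :=
  ((List.range n).filter fun i => φ (pref A i) && A i).length

/-- A sequence is Church random if every infinite subsequence selected by a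
computable selection rule satisfies the law of large numbers. -/
def ChurchRandom (A : Cantor) : Prop :=
  ∀ φ : List Bool → Bool, Computable φ →
    Filter.Tendsto (fun n => selCount φ A n) Filter.atTop Filter.atTop →
    Filter.Tendsto (fun n => (selOnes φ A n : ℝ) / (selCount φ A n : ℝ))
      Filter.atTop (nhds (1 / 2))

open Encodable

theorem computable_of_search {α : Type*} [Primcodable α] (p : α → ℕ → Bool) (hp : Computable₂ p)
    (f : α → ℕ) (hf : ∀ a, p a (f a) = true) (hu : ∀ a n, p a n = true → n = f a) :
    Computable f := by
  have h : Partrec fun a => Nat.rfind (fun n => Part.some (p a n)) :=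
    Partrec.rfind (p := fun a n => Part.some (p a n)) hp.partrec₂
  refine Partrec.of_eq h ?_
  intro a
  rw [PFun.coe_val, Part.eq_some_iff]
  refine Nat.mem_rfind.2 ⟨by simp [hf], ?_⟩
  intro m hm
  simp only [Part.mem_some_iff]
  cases h : p a m with
  | false => rfl
  | true => exact absurd (hu a m h) hm.ne

/-- codes of rationals, explicitly -/
def ratS (e : ℕ) : Prop :=
  0 < e.unpair.2 ∧ ¬ ∃ x < e.unpair.2 + 1, ((e.unpair.1 + 1) / 2) % x = 0 ∧ e.unpair.2 % x = 0 ∧ x ≠ 1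

instance : DecidablePred ratS := fun _ => by unfold ratS; infer_instance

/-- the encoding of rationals as pairs -/
def ratCode (q : ℚ) : ℕ := Nat.pair (encode q.num) q.den

theorem encz (z : ℤ) : @encode ℤ Int.encodable z = if 0 ≤ z then 2 * z.toNat else 2 * (-z).toNat - 1 := by
  cases z with
  | ofNat n => rfl
  | negSucc n => rfl

theorem encz_abs (z : ℤ) : (@encode ℤ Int.encodable z + 1) / 2 = z.natAbs := by
  rw [encz]; split_ifs <;> omega

theorem encz_surj (c : ℕ) : ∃ z : ℤ, @encode ℤ Int.encodable z = c := by
  rcases Nat.even_or_odd' c with ⟨k, h | h⟩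
  · exact ⟨k, by rw [encz]; split_ifs <;> omega⟩
  · exact ⟨-(k+1 : ℤ), by rw [encz]; split_ifs <;> omega⟩

theorem ratS_iff (e : ℕ) : ratS e ↔
    0 < e.unpair.2 ∧ ((e.unpair.1 + 1) / 2).Coprime e.unpair.2 := by
  unfold ratS
  refine and_congr_right fun h => ?_
  generalize (e.unpair.1 + 1) / 2 = a
  generalize e.unpair.2 = b at *
  constructor
  · intro hn
    by_contra hc
    apply hn
    refine ⟨Nat.gcd a b, Nat.lt_succ_of_le (Nat.gcd_le_right _ h), ?_, ?_, hc⟩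
    · exact Nat.mod_eq_zero_of_dvd (Nat.gcd_dvd_left _ _)
    · exact Nat.mod_eq_zero_of_dvd (Nat.gcd_dvd_right _ _)
  · rintro hc ⟨x, -, h1, h2, h3⟩
    exact h3 (Nat.eq_one_of_dvd_coprimes hc (Nat.dvd_of_mod_eq_zero h1) (Nat.dvd_of_mod_eq_zero h2))

theorem ratS_iff' (e : ℕ) : ratS e ↔ ∃ q, ratCode q = e := by
  rw [ratS_iff]
  constructor
  · rintro ⟨h1, h2⟩
    obtain ⟨z, hz⟩ := encz_surj e.unpair.1
    rw [← hz, encz_abs] at h2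
    refine ⟨⟨z, e.unpair.2, h1.ne', h2⟩, ?_⟩
    show Nat.pair (@encode ℤ Int.encodable z) _ = _
    rw [hz, Nat.pair_unpair]
  · rintro ⟨q, rfl⟩
    have : (ratCode q).unpair = (@encode ℤ Int.encodable q.num, q.den) := Nat.unpair_pair _ _
    rw [this]
    simp only
    rw [encz_abs]
    exact ⟨q.pos, q.reduced⟩

theorem enc_eq' (q : ℚ) : @encode ℚ (Primcodable.toEncodable) q =
  (List.range (@encode ℚ Rat.instEncodable q)).countP (fun x => @decide (x ∈ Set.range (@encode ℚ Rat.instEncodable)) (@decidableRangeEncode ℚ Rat.instEncodable x)) := by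
  rfl

/-- the code of a rational used by `Computable` -/
def qenc (q : ℚ) : ℕ := @encode ℚ (Primcodable.toEncodable) q

theorem qenc_comp : Computable qenc := Computable.encode

theorem ofNat_qenc (q : ℚ) : Denumerable.ofNat ℚ (qenc q) = q :=
  @Denumerable.ofNat_encode ℚ _ q

theorem qenc_ofNat (n : ℕ) : qenc (Denumerable.ofNat ℚ n) = n :=
  @Denumerable.encode_ofNat ℚ _ n

theorem enc_rat (q : ℚ) : qenc q = Nat.count ratS (ratCode q) := by
  unfold qenc
  rw [enc_eq']
  unfold Nat.count
  have : @encode ℚ Rat.instEncodable q = ratCode q := rfl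
  rw [this]
  apply List.countP_congr
  intro x _
  refine Iff.trans (@decide_eq_true_iff _ (@decidableRangeEncode ℚ Rat.instEncodable x)) ?_
  rw [decide_eq_true_iff, ratS_iff']
  rfl

theorem ratS_prim : PrimrecPred ratS := by
  have hu1 : Primrec fun e : ℕ => e.unpair.1 := Primrec.fst.comp Primrec.unpair
  have hu2 : Primrec fun e : ℕ => e.unpair.2 := Primrec.snd.comp Primrec.unpair
  have ha : Primrec fun e : ℕ => (e.unpair.1 + 1) / 2 :=
    Primrec.nat_div.comp (Primrec.succ.comp hu1) (Primrec.const 2)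
  have hR : PrimrecRel fun (x e : ℕ) =>
      ((e.unpair.1 + 1) / 2) % x = 0 ∧ e.unpair.2 % x = 0 ∧ x ≠ 1 := by
    refine PrimrecPred.and ?_ (PrimrecPred.and ?_ (PrimrecPred.not ?_))
    · exact Primrec.eq.comp (Primrec.nat_mod.comp (ha.comp Primrec.snd) Primrec.fst) (Primrec.const 0)
    · exact Primrec.eq.comp (Primrec.nat_mod.comp (hu2.comp Primrec.snd) Primrec.fst) (Primrec.const 0)
    · exact Primrec.eq.comp Primrec.fst (Primrec.const 1)
  unfold ratS
  refine PrimrecPred.and ?_ (PrimrecPred.not ?_)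
  · exact Primrec.nat_lt.comp (Primrec.const 0) hu2
  · exact hR.exists_lt.comp (Primrec.succ.comp hu2) Primrec.id

theorem count_prim : Primrec (Nat.count ratS) := by
  have h : Primrec fun n : ℕ => (Nat.rec 0 (fun k c => c + if ratS k then 1 else 0) n : ℕ) := by
    refine Primrec.nat_rec₁ (f := fun k c => c + if ratS k then 1 else 0) 0 ?_
    exact Primrec.nat_add.comp Primrec.snd
      (Primrec.ite (ratS_prim.comp Primrec.fst) (Primrec.const 1) (Primrec.const 0))
  refine h.of_eq ?_
  intro n
  induction n with
  | zero => simp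
  | succ n ih => rw [Nat.count_succ, ← ih]

theorem ratCode_comp : Computable ratCode := by
  refine computable_of_search (fun q n => decide (ratS n ∧ Nat.count ratS n = qenc q)) ?_ _ ?_ ?_
  · refine Computable.comp (f := fun a : ℕ × ℕ => decide (ratS a.2 ∧ Nat.count ratS a.2 = a.1))
      (g := fun a : ℚ × ℕ => (qenc a.1, a.2)) ?_ ?_
    · exact (PrimrecPred.decide (PrimrecPred.and (ratS_prim.comp Primrec.snd)
        (Primrec.eq.comp (count_prim.comp Primrec.snd) Primrec.fst))).to_comp
    · exact (qenc_comp.comp Computable.fst).pair Computable.snd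
  · intro q
    simp only [decide_eq_true_iff]
    exact ⟨(ratS_iff' _).2 ⟨q, rfl⟩, (enc_rat q).symm⟩
  · intro q n h
    simp only [decide_eq_true_iff] at h
    refine Nat.count_injective h.1 ((ratS_iff' _).2 ⟨q, rfl⟩) ?_
    rw [h.2, enc_rat]

theorem rat_den_comp : Computable fun q : ℚ => q.den := by
  refine (Computable.snd.comp (Computable.unpair.comp ratCode_comp)).of_eq ?_
  intro q
  simp [ratCode]

theorem rat_pos_comp : Computable fun q : ℚ => q.num.toNat := by
  have h : Primrec fun c : ℕ => if c % 2 = 0 then c / 2 else 0 :=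
    Primrec.ite (Primrec.eq.comp (Primrec.nat_mod.comp Primrec.id (Primrec.const 2)) (Primrec.const 0))
      (Primrec.nat_div.comp Primrec.id (Primrec.const 2)) (Primrec.const 0)
  refine (h.to_comp.comp (Computable.fst.comp (Computable.unpair.comp ratCode_comp))).of_eq ?_
  intro q
  simp only [ratCode, Nat.unpair_pair]
  have := encz q.num
  rw [this]
  split_ifs <;> omega

theorem rat_neg_comp : Computable fun q : ℚ => (-q.num).toNat := by
  have h : Primrec fun c : ℕ => if c % 2 = 0 then 0 else (c + 1) / 2 :=
    Primrec.ite (Primrec.eq.comp (Primrec.nat_mod.comp Primrec.id (Primrec.const 2)) (Primrec.const 0))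
      (Primrec.const 0) (Primrec.nat_div.comp Primrec.succ (Primrec.const 2))
  refine (h.to_comp.comp (Computable.fst.comp (Computable.unpair.comp ratCode_comp))).of_eq ?_
  intro q
  simp only [ratCode, Nat.unpair_pair]
  have := encz q.num
  rw [this]
  split_ifs <;> omega

theorem mk_rat_comp {α : Type*} [Primcodable α] (N M : α → ℕ) (hN : Computable N)
    (hM : Computable M) (hpos : ∀ a, 0 < M a) : Computable fun a => (N a : ℚ) / (M a : ℚ) := by
  suffices h : Computable fun a => qenc ((N a : ℚ) / (M a : ℚ)) by
    exact ((Computable.ofNat ℚ).comp h).of_eq fun a => ofNat_qenc _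
  have key : ∀ a (q : ℚ), (q.num.toNat * M a = N a * q.den ∧ (-q.num).toNat = 0) ↔
      q = (N a : ℚ) / (M a : ℚ) := by
    intro a q
    have hM' : (M a : ℚ) ≠ 0 := by exact_mod_cast (hpos a).ne'
    have hd : (q.den : ℚ) ≠ 0 := by exact_mod_cast q.pos.ne'
    have e1 : q = (q.num : ℚ) / q.den := (Rat.num_div_den q).symm
    constructor
    · rintro ⟨h1, h2⟩
      have h3 : q.num = (q.num.toNat : ℤ) := by omega
      rw [e1, h3, div_eq_div_iff hd hM']
      exact_mod_cast h1
    · intro h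
      have hq : 0 ≤ q := by rw [h]; positivity
      have hn : 0 ≤ q.num := Rat.num_nonneg.2 hq
      refine ⟨?_, by omega⟩
      rw [e1, div_eq_div_iff hd hM'] at h
      have h3 : q.num = (q.num.toNat : ℤ) := by omega
      rw [h3] at h
      exact_mod_cast h
  refine computable_of_search (fun a n => decide ((Denumerable.ofNat ℚ n).num.toNat * M a =
    N a * (Denumerable.ofNat ℚ n).den ∧ (-(Denumerable.ofNat ℚ n).num).toNat = 0)) ?_ _ ?_ ?_
  · have hq : Computable fun x : α × ℕ => Denumerable.ofNat ℚ x.2 :=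
      (Computable.ofNat ℚ).comp Computable.snd
    refine Computable.comp (f := fun a : (ℕ × ℕ) × ℕ => decide (a.1.1 = a.1.2 ∧ a.2 = 0))
      (g := fun x : α × ℕ => (((Denumerable.ofNat ℚ x.2).num.toNat * M x.1,
        N x.1 * (Denumerable.ofNat ℚ x.2).den), (-(Denumerable.ofNat ℚ x.2).num).toNat)) ?_ ?_
    · exact (PrimrecPred.decide (PrimrecPred.and
        (Primrec.eq.comp (Primrec.fst.comp Primrec.fst) (Primrec.snd.comp Primrec.fst))
        (Primrec.eq.comp Primrec.snd (Primrec.const 0)))).to_comp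
    · refine Computable.pair (Computable.pair ?_ ?_) ?_
      · exact Primrec.nat_mul.to_comp.comp (rat_pos_comp.comp hq) (hM.comp Computable.fst)
      · exact Primrec.nat_mul.to_comp.comp (hN.comp Computable.fst) (rat_den_comp.comp hq)
      · exact rat_neg_comp.comp hq
  · intro a
    simp only [decide_eq_true_iff]
    rw [key, ofNat_qenc]
  · intro a n h
    simp only [decide_eq_true_iff] at h
    rw [key] at h
    rw [← h, qenc_ofNat]

/-- boolean test for powers of two -/
def isPow (n : ℕ) : Bool := decide (∃ k < n + 1, n = 2 ^ k)

theorem isPow_iff (n : ℕ) : isPow n = true ↔ ∃ k : ℕ, n = 2 ^ k := by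
  unfold isPow
  rw [decide_eq_true_iff]
  constructor
  · rintro ⟨k, -, h⟩; exact ⟨k, h⟩
  · rintro ⟨k, h⟩
    have := @Nat.lt_two_pow_self k
    exact ⟨k, by omega, h⟩

theorem pow_prim : Primrec₂ fun b k : ℕ => b ^ k := by
  have h : Primrec₂ fun b k : ℕ => (Nat.rec 1 (fun _ c => c * b) k : ℕ) := by
    refine Primrec.nat_rec (f := fun _ : ℕ => 1) (g := fun b x => x.2 * b) (Primrec.const 1) ?_
    exact Primrec.nat_mul.comp (Primrec.snd.comp Primrec.snd) Primrec.fst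
  refine h.of_eq ?_
  intro b k
  induction k with
  | zero => simp
  | succ k ih => rw [pow_succ, ← ih]

theorem isPow_prim : Primrec isPow := by
  have hR : PrimrecRel fun k n : ℕ => n = 2 ^ k :=
    Primrec.eq.comp Primrec.snd (pow_prim.comp (Primrec.const 2) Primrec.fst)
  exact PrimrecPred.decide (hR.exists_lt.comp Primrec.succ Primrec.id)

theorem clog_pow (n : ℕ) (h : isPow n = true) : Nat.clog 2 (n + 1) = Nat.clog 2 n + 1 := by
  obtain ⟨k, rfl⟩ := (isPow_iff n).1 h
  rw [Nat.clog_pow _ _ (by norm_num)]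
  apply le_antisymm
  · rw [Nat.clog_le_iff_le_pow (by norm_num), pow_succ]
    have := Nat.one_le_two_pow (n := k)
    omega
  · rw [Nat.succ_le_iff, Nat.lt_clog_iff_pow_lt (by norm_num)]
    omega

theorem clog_not_pow (n : ℕ) (h : isPow n = false) : Nat.clog 2 (n + 1) = Nat.clog 2 n := by
  apply le_antisymm
  · rw [Nat.clog_le_iff_le_pow (by norm_num)]
    have h1 := Nat.le_pow_clog (b := 2) (by norm_num) n
    have h2 : n ≠ 2 ^ Nat.clog 2 n := by
      intro h3
      have := (isPow_iff n).2 ⟨_, h3⟩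
      simp [h] at this
    omega
  · exact Nat.clog_mono_right _ (by omega)

theorem two_pow_clog_le (n : ℕ) : 2 ^ Nat.clog 2 n ≤ 2 * (n + 1) := by
  rcases Nat.lt_or_ge 1 n with h | h
  · have h1 := Nat.pow_pred_clog_lt_self (b := 2) (by norm_num) h
    have h2 := Nat.clog_pos (b := 2) (by norm_num) h
    obtain ⟨c, hc⟩ : ∃ c, Nat.clog 2 n = c + 1 := ⟨Nat.clog 2 n - 1, by omega⟩
    rw [hc] at h1 ⊢
    simp only [Nat.pred_eq_sub_one, Nat.add_sub_cancel] at h1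
    rw [pow_succ]; omega
  · rw [Nat.clog_of_right_le_one h]; omega

/-- zeroing at the powers of two -/
def zer (R : Cantor) : Cantor := fun n => bif isPow n then false else R n

theorem pref_succ (X : Cantor) (n : ℕ) : pref X (n + 1) = pref X n ++ [X n] := by
  simp [pref, List.range_succ]

theorem pref_length (X : Cantor) (n : ℕ) : (pref X n).length = n := by simp [pref]

theorem foldl_comp {σ : Type*} [Primcodable σ] (step : σ → Bool → σ) (hs : Computable₂ step)
    (s0 : σ) : Computable fun w : List Bool => w.foldl step s0 := by
  have h : Computable fun w : List Bool => (Nat.rec s0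
      (fun i s => Option.casesOn (w[i]?) s (fun b => step s b)) w.length : σ) := by
    refine Computable.nat_rec (f := fun w : List Bool => w.length) (g := fun _ => s0)
      (h := fun w x => Option.casesOn (w[x.1]?) x.2 (fun b => step x.2 b))
      Computable.list_length (Computable.const s0) ?_
    refine Computable.option_casesOn (o := fun y : List Bool × (ℕ × σ) => y.1[y.2.1]?)
      (f := fun y => y.2.2) (g := fun y b => step y.2.2 b) ?_ ?_ ?_
    · exact Computable.list_getElem?.comp Computable.fst (Computable.fst.comp Computable.snd)
    · exact Computable.snd.comp Computable.snd
    · exact hs.comp (Computable.snd.comp (Computable.snd.comp Computable.fst)) Computable.snd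
  refine h.of_eq ?_
  intro w
  have key : ∀ n ≤ w.length, (Nat.rec s0
      (fun i s => Option.casesOn (w[i]?) s (fun b => step s b)) n : σ) = (w.take n).foldl step s0 := by
    intro n
    induction n with
    | zero => simp
    | succ n ih =>
      intro hn
      have hn' : n < w.length := hn
      simp only [ih hn'.le]
      rw [List.take_succ_eq_append_getElem hn', List.foldl_append, List.getElem?_eq_getElem hn']
      rfl
  rw [key _ le_rfl, List.take_length]

theorem realFun_of_nat (N M : List Bool → ℕ) (hN : Computable N)
    (hM : Computable M) (hpos : ∀ a, 0 < M a) :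
    ComputableRealFun fun w => (N w : ℝ) / (M w : ℝ) := by
  refine ⟨fun w _ => (N w : ℚ) / (M w : ℚ), ?_, ?_⟩
  · exact (mk_rat_comp N M hN hM hpos).comp Computable.fst
  · intro w n
    push_cast
    rw [sub_self, abs_zero]
    positivity

/-! ### the martingale succeeding on `zer R` -/

/-- one step -/
def eStep (x : ℕ × ℕ) (b : Bool) : ℕ × ℕ :=
  (x.1 + 1, bif isPow x.1 then (bif b then 0 else 2 * x.2) else x.2)

theorem eStep_comp : Computable₂ eStep := by
  have h1 : Computable fun y : (ℕ × ℕ) × Bool => y.1.1 := Computable.fst.comp Computable.fst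
  have h2 : Computable fun y : (ℕ × ℕ) × Bool => y.1.2 := Computable.snd.comp Computable.fst
  refine Computable.pair (Computable.succ.comp h1) ?_
  refine Computable.cond (isPow_prim.to_comp.comp h1) ?_ h2
  refine Computable.cond Computable.snd (Computable.const 0) ?_
  exact Primrec.nat_mul.to_comp.comp (Computable.const 2) h2

/-- state after reading a string -/
def eSt (w : List Bool) : ℕ × ℕ := w.foldl eStep (0, 1)

theorem eSt_append (w : List Bool) (b : Bool) : eSt (w ++ [b]) = eStep (eSt w) b := by
  simp [eSt]

theorem eSt_pref (R : Cantor) (n : ℕ) : eSt (pref (zer R) n) = (n, 2 ^ Nat.clog 2 n) := by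
  induction n with
  | zero => simp [pref, eSt]
  | succ n ih =>
    rw [pref_succ, eSt_append, ih]
    cases h : isPow n with
    | true => simp [eStep, zer, h, clog_pow n h, pow_succ, mul_comm]
    | false => simp [eStep, zer, h, clog_not_pow n h]

theorem one_mem (R : Cantor) : ∃ d : List Bool → ℝ,
    ComputableRealFun d ∧ IsSGale 1 d ∧ ∀ X ∈ ({zer R} : Set Cantor), SucceedsOn d X := by
  refine ⟨fun w => ((eSt w).2 : ℝ) / ((1 : ℕ) : ℝ), ?_, ⟨?_, ?_⟩, ?_⟩
  · exact realFun_of_nat (fun w => (eSt w).2) (fun _ => 1)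
      (Computable.snd.comp (foldl_comp eStep eStep_comp (0, 1))) (Computable.const 1) (by simp)
  · intro w; positivity
  · intro w
    simp only [eSt_append, Nat.cast_one, div_one, Real.rpow_one]
    cases h : isPow (eSt w).1 <;> simp [eStep, h]
    ring
  · rintro X rfl C
    obtain ⟨m, hm⟩ := exists_nat_gt C
    refine ⟨2 ^ m, ?_⟩
    simp only [eSt_pref, Nat.clog_pow 2 m (by norm_num), Nat.cast_one, div_one]
    refine hm.trans ?_
    exact_mod_cast Nat.lt_two_pow_self

/-! ### the rational martingale built from an `s`-gale -/

/-- one step -/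
def dStep (T : List Bool → ℕ) (x : List Bool × (ℕ × ℕ)) (b : Bool) : List Bool × (ℕ × ℕ) :=
  (x.1 ++ [bif isPow x.1.length then false else b],
    bif isPow x.1.length then x.2 else
      (x.2.1 * (2 * T (x.1 ++ [b])), x.2.2 * (T (x.1 ++ [false]) + T (x.1 ++ [true]))))

theorem dStep_comp (T : List Bool → ℕ) (hT : Computable T) : Computable₂ (dStep T) := by
  have h1 : Computable fun y : (List Bool × (ℕ × ℕ)) × Bool => y.1.1 :=
    Computable.fst.comp Computable.fst
  have h2 : Computable fun y : (List Bool × (ℕ × ℕ)) × Bool => y.1.2 :=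
    Computable.snd.comp Computable.fst
  have hp : Computable fun y : (List Bool × (ℕ × ℕ)) × Bool => isPow y.1.1.length :=
    isPow_prim.to_comp.comp (Computable.list_length.comp h1)
  refine Computable.pair ?_ ?_
  · exact Computable.list_concat.comp h1 (Computable.cond hp (Computable.const false) Computable.snd)
  · refine Computable.cond hp h2 (Computable.pair ?_ ?_)
    · refine Primrec.nat_mul.to_comp.comp (Computable.fst.comp h2)
        (Primrec.nat_mul.to_comp.comp (Computable.const 2) (hT.comp ?_))
      exact Computable.list_concat.comp h1 Computable.snd
    · refine Primrec.nat_mul.to_comp.comp (Computable.snd.comp h2)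
        (Primrec.nat_add.to_comp.comp (hT.comp ?_) (hT.comp ?_))
      · exact Computable.list_concat.comp h1 (Computable.const false)
      · exact Computable.list_concat.comp h1 (Computable.const true)

/-- state after reading a string -/
def dSt (T : List Bool → ℕ) (w : List Bool) : List Bool × (ℕ × ℕ) := w.foldl (dStep T) ([], (1, 1))

theorem dSt_append (T : List Bool → ℕ) (w : List Bool) (b : Bool) :
    dSt T (w ++ [b]) = dStep T (dSt T w) b := by
  simp [dSt]

theorem dSt_pos (T : List Bool → ℕ) (hT : ∀ v, 0 < T v) (w : List Bool) : 0 < (dSt T w).2.2 := by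
  induction w using List.reverseRecOn with
  | nil => simp [dSt]
  | append_singleton w b ih =>
    rw [dSt_append]
    unfold dStep
    cases h : isPow (dSt T w).1.length
    · have := hT ((dSt T w).1 ++ [false])
      simp only [cond_false]
      positivity
    · simpa using ih

/-- the martingale -/
noncomputable def dM (T : List Bool → ℕ) (w : List Bool) : ℝ :=
  ((dSt T w).2.1 : ℝ) / ((dSt T w).2.2 : ℝ)

theorem dM_comp (T : List Bool → ℕ) (hT : Computable T) (hpos : ∀ v, 0 < T v) :
    ComputableRealFun (dM T) := by
  have h := foldl_comp (dStep T) (dStep_comp T hT) ([], (1, 1))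
  exact realFun_of_nat (fun w => (dSt T w).2.1) (fun w => (dSt T w).2.2)
    (Computable.fst.comp (Computable.snd.comp h)) (Computable.snd.comp (Computable.snd.comp h))
    (dSt_pos T hpos)

theorem dM_append (T : List Bool → ℕ) (w : List Bool) (b : Bool) :
    dM T (w ++ [b]) = bif isPow (dSt T w).1.length then dM T w else
      dM T w * (2 * T ((dSt T w).1 ++ [b]) /
        (T ((dSt T w).1 ++ [false]) + T ((dSt T w).1 ++ [true]))) := by
  unfold dM
  rw [dSt_append]
  unfold dStep
  cases h : isPow (dSt T w).1.length
  · simp only [cond_false]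
    push_cast
    rw [div_mul_div_comm]
  · simp

theorem dM_mart (T : List Bool → ℕ) (hpos : ∀ v, 0 < T v) : IsMartingale (dM T) := by
  refine ⟨fun w => by unfold dM; positivity, ?_⟩
  intro w
  rw [dM_append, dM_append]
  cases h : isPow (dSt T w).1.length
  · simp only [cond_false]
    have h0 : (0 : ℝ) < T ((dSt T w).1 ++ [false]) := by exact_mod_cast hpos _
    have h1 : (0 : ℝ) < T ((dSt T w).1 ++ [true]) := by exact_mod_cast hpos _
    field_simp
  · simp only [cond_true]; ring

theorem dSt_pref (T : List Bool → ℕ) (R : Cantor) (n : ℕ) :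
    (dSt T (pref R n)).1 = pref (zer R) n := by
  induction n with
  | zero => simp [pref, dSt]
  | succ n ih =>
    rw [pref_succ, dSt_append, pref_succ]
    simp only [dStep, ih, pref_length, zer]

theorem dM_ineq (T : List Bool → ℕ) (hpos : ∀ v, 0 < T v) (R : Cantor) (c : ℝ) (hc : 1 ≤ c)
    (hT : ∀ v, (T (v ++ [false]) : ℝ) + T (v ++ [true]) ≤ 8 * c * T v) (n : ℕ) :
    2 ^ n * ((T (pref (zer R) n) : ℝ) / 8 ^ n) ≤
      c ^ n * 2 ^ Nat.clog 2 n * dM T (pref R n) * T [] := by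
  induction n with
  | zero => simp [pref, dM, dSt]
  | succ n ih =>
    rw [pref_succ R, dM_append, dSt_pref, pref_length, pref_succ]
    set v := pref (zer R) n
    have h0 : (0 : ℝ) < T (v ++ [false]) := by exact_mod_cast hpos _
    have h1 : (0 : ℝ) < T (v ++ [true]) := by exact_mod_cast hpos _
    have hv : (0 : ℝ) < T v := by exact_mod_cast hpos _
    have hTv := hT v
    have hc0 : 0 < c := by linarith
    cases h : isPow n with
    | true =>
      simp only [cond_true, zer, h, clog_pow n h]
      have e1 : (2 : ℝ) ^ (n + 1) * ((T (v ++ [false]) : ℝ) / 8 ^ (n + 1)) ≤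
          2 * c * (2 ^ n * ((T v : ℝ) / 8 ^ n)) := by
        have : (T (v ++ [false]) : ℝ) ≤ 8 * c * T v := by linarith
        calc (2 : ℝ) ^ (n + 1) * ((T (v ++ [false]) : ℝ) / 8 ^ (n + 1)) 
            ≤ (2 : ℝ) ^ (n + 1) * ((8 * c * T v) / 8 ^ (n + 1)) := by gcongr
          _ = _ := by field_simp; ring
      calc _ ≤ _ := e1
        _ ≤ 2 * c * (c ^ n * 2 ^ Nat.clog 2 n * dM T (pref R n) * T []) := by gcongr
        _ = _ := by ring
    | false =>
      simp only [cond_false, zer, h, clog_not_pow n h]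
      set b := R n
      have hb : (0 : ℝ) < T (v ++ [b]) := by exact_mod_cast hpos _
      set S := (T (v ++ [false]) : ℝ) + T (v ++ [true]) with hS
      have hSpos : 0 < S := by positivity
      calc (2 : ℝ) ^ (n + 1) * ((T (v ++ [b]) : ℝ) / 8 ^ (n + 1))
          = (2 ^ n * ((T v : ℝ) / 8 ^ n)) * (c * (2 * T (v ++ [b]) / (8 * c * T v))) := by
            field_simp
            try ring
        _ ≤ (2 ^ n * ((T v : ℝ) / 8 ^ n)) * (c * (2 * T (v ++ [b]) / S)) := by gcongr
        _ ≤ (c ^ n * 2 ^ Nat.clog 2 n * dM T (pref R n) * T []) * (c * (2 * T (v ++ [b]) / S)) := by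
            gcongr
        _ = _ := by ring

theorem dM_succ (T : List Bool → ℕ) (hpos : ∀ v, 0 < T v) (R : Cantor) (c : ℝ) (hc : 1 ≤ c)
    (hc2 : c < 2) (d : List Bool → ℝ) (hd : ∀ v, d v * 8 ^ v.length ≤ T v)
    (hT : ∀ v, (T (v ++ [false]) : ℝ) + T (v ++ [true]) ≤ 8 * c * T v)
    (hs : SucceedsOn d (zer R)) : SucceedsOn (dM T) R := by
  intro C
  have ht : (0 : ℝ) < T [] := by exact_mod_cast hpos _
  have hc0 : 0 < c := by linarith
  set r := 2 / c with hr
  have hr1 : 0 < r - 1 := by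
    rw [sub_pos, hr, lt_div_iff₀ hc0]; linarith
  have hr2 : r ≤ 2 := by
    rw [hr, div_le_iff₀ hc0]; linarith
  obtain ⟨n, hn⟩ := hs (max C 0 * (2 * T []) / (r - 1))
  refine ⟨n, ?_⟩
  have h1 := dM_ineq T hpos R c hc hT n
  have h2 : (r - 1) * (n + 1) ≤ r ^ n := by
    have := one_add_mul_le_pow (a := r - 1) (by linarith) n
    rw [add_sub_cancel] at this
    nlinarith
  have h3 : (2 : ℝ) ^ Nat.clog 2 n ≤ 2 * (n + 1) := by exact_mod_cast two_pow_clog_le n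
  have h4 : d (pref (zer R) n) ≤ (T (pref (zer R) n) : ℝ) / 8 ^ n := by
    rw [le_div_iff₀ (by positivity)]
    simpa [pref_length] using hd (pref (zer R) n)
  have hD : 0 ≤ dM T (pref R n) := (dM_mart T hpos).1 _
  rw [div_lt_iff₀ hr1] at hn
  set x := d (pref (zer R) n)
  have hx : 0 ≤ x := by
    by_contra hx
    have : x * (r - 1) < 0 := mul_neg_of_neg_of_pos (not_le.1 hx) hr1
    have : 0 ≤ max C 0 * (2 * (T [] : ℝ)) := by positivity
    linarith
  have e2 : (2 : ℝ) ^ n = r ^ n * c ^ n := by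
    rw [hr, div_pow]; field_simp
  have h5 : r ^ n * x ≤ 2 ^ Nat.clog 2 n * dM T (pref R n) * T [] := by
    have : c ^ n * (r ^ n * x) ≤ c ^ n * (2 ^ Nat.clog 2 n * dM T (pref R n) * T []) := by
      calc c ^ n * (r ^ n * x) = 2 ^ n * x := by rw [e2]; ring
        _ ≤ 2 ^ n * ((T (pref (zer R) n) : ℝ) / 8 ^ n) := by gcongr
        _ ≤ _ := h1
        _ = _ := by ring
    exact le_of_mul_le_mul_left this (by positivity)
  have h6 : ((n : ℝ) + 1) * (x * (r - 1)) ≤ (n + 1) * (dM T (pref R n) * (2 * T [])) := by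
    calc ((n : ℝ) + 1) * (x * (r - 1)) = ((r - 1) * (n + 1)) * x := by ring
      _ ≤ r ^ n * x := by gcongr
      _ ≤ _ := h5
      _ ≤ (2 * (n + 1)) * dM T (pref R n) * T [] := by gcongr
      _ = _ := by ring
  have h7 := le_of_mul_le_mul_left h6 (by positivity)
  have h8 : max C 0 * (2 * (T [] : ℝ)) < dM T (pref R n) * (2 * T []) := lt_of_lt_of_le hn h7
  have h9 := lt_of_mul_lt_mul_right h8 (by positivity)
  exact lt_of_le_of_lt (le_max_left _ _) h9

/-- natural approximation of `8^|v| d(v)` -/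
def tApp (g : List Bool → ℕ → ℚ) (v : List Bool) : ℕ :=
  ((g v (3 * v.length)).num.toNat * 8 ^ v.length + 3 * (g v (3 * v.length)).den
    - (-(g v (3 * v.length)).num).toNat * 8 ^ v.length) / (g v (3 * v.length)).den

theorem tApp_comp (g : List Bool → ℕ → ℚ) (hg : Computable₂ g) : Computable (tApp g) := by
  have hq : Computable fun v : List Bool => g v (3 * v.length) :=
    hg.comp Computable.id (Primrec.nat_mul.to_comp.comp (Computable.const 3) Computable.list_length)
  have hp : Computable fun v : List Bool => 8 ^ v.length :=
    pow_prim.to_comp.comp (Computable.const 8) Computable.list_length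
  have hden := rat_den_comp.comp hq
  refine Primrec.nat_div.to_comp.comp (Primrec.nat_sub.to_comp.comp (Primrec.nat_add.to_comp.comp
    (Primrec.nat_mul.to_comp.comp (rat_pos_comp.comp hq) hp)
    (Primrec.nat_mul.to_comp.comp (Computable.const 3) hden))
    (Primrec.nat_mul.to_comp.comp (rat_neg_comp.comp hq) hp)) hden

theorem floor_aux (q : ℚ) (K : ℕ) (h : 0 ≤ (q : ℝ) * K + 3) :
    (q : ℝ) * K + 2 ≤ (((q.num.toNat * K + 3 * q.den - (-q.num).toNat * K) / q.den : ℕ) : ℝ) ∧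
    (((q.num.toNat * K + 3 * q.den - (-q.num).toNat * K) / q.den : ℕ) : ℝ) ≤ (q : ℝ) * K + 3 := by
  have hd : (0 : ℝ) < q.den := by exact_mod_cast q.pos
  have hq : (q : ℝ) = (q.num : ℝ) / q.den := by exact_mod_cast (Rat.num_div_den q).symm
  have hz : (q.num : ℝ) = (q.num.toNat : ℝ) - ((-q.num).toNat : ℝ) := by
    have : q.num = (q.num.toNat : ℤ) - ((-q.num).toNat : ℤ) := by omega
    exact_mod_cast this
  set a := q.num.toNat
  set b := (-q.num).toNat
  have e : ((q : ℝ) * K + 3) * q.den = a * K + 3 * q.den - b * K := by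
    rw [hq, hz]; field_simp; ring
  have hle : b * K ≤ a * K + 3 * q.den := by
    have : (0 : ℝ) ≤ a * K + 3 * q.den - b * K := by rw [← e]; positivity
    have : (b : ℝ) * K ≤ a * K + 3 * q.den := by linarith
    exact_mod_cast this
  set X := a * K + 3 * q.den - b * K with hX
  have hXr : (X : ℝ) = ((q : ℝ) * K + 3) * q.den := by
    rw [e, hX, Nat.cast_sub hle]; push_cast; ring
  have f1 : X / q.den * q.den ≤ X := Nat.div_mul_le_self _ _
  have f2 : X < (X / q.den + 1) * q.den := by
    have := Nat.lt_div_mul_add (a := X) q.pos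
    linarith
  have g1 : ((X / q.den : ℕ) : ℝ) * q.den ≤ ((q : ℝ) * K + 3) * q.den := by
    rw [← hXr]; exact_mod_cast f1
  have g2 : ((q : ℝ) * K + 3) * q.den < (((X / q.den : ℕ) : ℝ) + 1) * q.den := by
    rw [← hXr]; exact_mod_cast f2
  have g1' := le_of_mul_le_mul_right g1 hd
  have g2' := lt_of_mul_lt_mul_right g2 hd.le
  exact ⟨by linarith, g1'⟩

theorem tApp_bd (g : List Bool → ℕ → ℚ) (d : List Bool → ℝ) (hd : ∀ v, 0 ≤ d v)
    (hg : ∀ w n, |d w - (g w n : ℝ)| ≤ (2 : ℝ)⁻¹ ^ n) (v : List Bool) :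
    d v * 8 ^ v.length + 1 ≤ tApp g v ∧ (tApp g v : ℝ) ≤ d v * 8 ^ v.length + 4 := by
  have h := hg v (3 * v.length)
  rw [pow_mul] at h
  norm_num at h
  have hK : (0 : ℝ) < 8 ^ v.length := by positivity
  have hh : ((1 : ℝ) / 8) ^ v.length * 8 ^ v.length = 1 := by
    rw [← mul_pow]; norm_num
  rw [abs_le] at h
  obtain ⟨ha, hb⟩ := h
  have ha' := mul_le_mul_of_nonneg_right ha hK.le
  have hb' := mul_le_mul_of_nonneg_right hb hK.le
  rw [hh] at hb'
  rw [neg_mul, hh] at ha'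
  have hdv := mul_nonneg (hd v) hK.le
  rw [sub_mul] at ha' hb'
  have := floor_aux (g v (3 * v.length)) (8 ^ v.length) (by push_cast; linarith)
  push_cast at this
  unfold tApp
  push_cast
  constructor
  · linarith [this.1]
  · linarith [this.2]

theorem one_le_of_mem (R : Cantor) (hR : ComputablyRandom R) (s : ℝ) (hs : 0 ≤ s)
    (d : List Bool → ℝ) (hd : ComputableRealFun d) (hg : IsSGale s d)
    (hsu : SucceedsOn d (zer R)) : 1 ≤ s := by
  by_contra hlt
  rw [not_le] at hlt
  obtain ⟨g, hgc, hgb⟩ := hd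
  have hb := tApp_bd g d hg.1 hgb
  have hpos : ∀ v, 0 < tApp g v := by
    intro v
    have h1 := (hb v).1
    have h2 : 0 ≤ d v * 8 ^ v.length := mul_nonneg (hg.1 v) (by positivity)
    have : (0 : ℝ) < tApp g v := by linarith
    exact_mod_cast this
  have hc : (1 : ℝ) ≤ 2 ^ s := Real.one_le_rpow (by norm_num) hs
  have hc2 : (2 : ℝ) ^ s < 2 := by
    calc (2 : ℝ) ^ s < 2 ^ (1 : ℝ) := Real.rpow_lt_rpow_of_exponent_lt (by norm_num) hlt
      _ = 2 := Real.rpow_one 2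
  refine hR (dM (tApp g)) (dM_comp _ (tApp_comp g hgc) hpos) (dM_mart _ hpos) ?_
  refine dM_succ (tApp g) hpos R (2 ^ s) hc hc2 d (fun v => by linarith [(hb v).1]) ?_ hsu
  intro v
  have h0 := (hb (v ++ [false])).2
  have h1 := (hb (v ++ [true])).2
  have h2 := (hb v).1
  simp only [List.length_append, List.length_singleton, pow_succ] at h0 h1
  have h3 := hg.2 v
  calc (tApp g (v ++ [false]) : ℝ) + tApp g (v ++ [true])
      ≤ 8 * (d (v ++ [false]) + d (v ++ [true])) * 8 ^ v.length + 8 := by linarith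
    _ = 8 * 2 ^ s * (d v * 8 ^ v.length) + 8 := by rw [← h3]; ring
    _ ≤ 8 * 2 ^ s * (d v * 8 ^ v.length + 1) := by linarith
    _ ≤ _ := by gcongr

theorem compdim_zer (R : Cantor) (hR : ComputablyRandom R) : compdim {zer R} = 1 := by
  apply IsLeast.csInf_eq
  refine ⟨⟨zero_le_one, one_mem R⟩, ?_⟩
  rintro s ⟨hs, d, hd, hg, hsu⟩
  exact one_le_of_mem R hR s hs d hd hg (hsu _ rfl)

theorem selCount_zer (R : Cantor) (n : ℕ) :
    selCount (fun w => isPow w.length) (zer R) n = Nat.clog 2 n := by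
  induction n with
  | zero => simp [selCount]
  | succ n ih =>
    unfold selCount at ih ⊢
    rw [List.range_succ, List.filter_append, List.length_append, ih]
    cases h : isPow n with
    | true => simp [pref_length, h, clog_pow n h]
    | false => simp [pref_length, h, clog_not_pow n h]

theorem selOnes_zer (R : Cantor) (n : ℕ) :
    selOnes (fun w => isPow w.length) (zer R) n = 0 := by
  unfold selOnes
  rw [List.length_eq_zero_iff, List.filter_eq_nil_iff]
  intro i _
  cases h : isPow i <;> simp [pref_length, zer, h]

theorem not_church (R : Cantor) : ¬ ChurchRandom (zer R) := by
  intro h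
  have h1 := h (fun w => isPow w.length) (isPow_prim.to_comp.comp Computable.list_length) ?_
  · simp only [selOnes_zer, Nat.cast_zero, zero_div] at h1
    have := tendsto_nhds_unique h1 tendsto_const_nhds
    norm_num at this
  · simp only [selCount_zer]
    refine tendsto_atTop_mono' _ (Eventually.of_forall fun n => Nat.log_le_clog 2 n) ?_
    refine tendsto_atTop_atTop.2 fun b => ⟨2 ^ b, fun a ha => ?_⟩
    exact Nat.le_log_of_pow_le (by norm_num) ha

open scoped Classical in
theorem zer_eq (R : Cantor) :
    (fun n : ℕ => if ∃ k : ℕ, n = 2 ^ k then false else R n) = zer R := by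
  funext n
  unfold zer
  cases h : isPow n with
  | true => rw [if_pos ((isPow_iff n).1 h)]; rfl
  | false =>
    rw [if_neg]; · rfl
    intro h'
    rw [(isPow_iff n).2 h'] at h
    cases h

open scoped Classical in
/-- There are sequences of computable dimension 1 that are not Church random:
zeroing out a computably random sequence `R` at the powers of two yields a
sequence `A` with `compdim {A} = 1` that is not Church random. -/
theorem compdim_one_not_Church_random (R : Cantor) (hR : ComputablyRandom R) :
    compdim {fun n : ℕ => if ∃ k : ℕ, n = 2 ^ k then false else R n} = 1 ∧
    ¬ ChurchRandom (fun n : ℕ => if ∃ k : ℕ, n = 2 ^ k then false else R n) := by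
  rw [zer_eq]
  exact ⟨compdim_zer R hR, not_church R⟩
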